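/- For n >= 1 and k >= 1, the number of flattened {1}-insertion parking functions of order n with exactly k+1 runs equals T(n,k), the number of set partitions of [n] with exactly k blocks of size at least two. -/

import Mathlib

namespace FlatPF

/-- Decomposition of a word into maximal weakly increasing runs. -/
def runs : List ℕ → List (List ℕ)
  | [] => []
  | a :: l =>
    match runs l with
    | [] => [[a]]
    | [] :: rs => [a] :: rs
    | (b :: t) :: rs => if a ≤ b then (a :: b :: t) :: rs else [a] :: (b :: t) :: rs

/-- The number of maximal weakly increasing runs of a word. -/
def numRuns (w : List ℕ) : ℕ := (runs w).length

/-- A word is flattened if the leading values of its runs are weakly increasing. -/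
def IsFlattened (w : List ℕ) : Prop :=
  List.Chain' (· ≤ ·) ((runs w).map (fun r => r.headD 0))

/-- A word is a parking function: entries in `[m]` and the weakly increasing
rearrangement `(a'_1, …, a'_m)` satisfies `a'_i ≤ i`. -/
def IsPF (w : List ℕ) : Prop :=
  (∀ x ∈ w, 1 ≤ x ∧ x ≤ w.length) ∧
  ∀ i < w.length, (w.mergeSort (· ≤ ·)).getD i 0 ≤ i + 1

/-- `w` is obtained by inserting the elements of the multiset `S` into some
permutation of `[n]`, keeping the letters of the permutation in relative order. -/
def IsInsertion (S : Multiset ℕ) (n : ℕ) (w : List ℕ) : Prop :=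
  (↑w : Multiset ℕ) = ↑(List.range' 1 n) + S ∧
  ∃ p : List ℕ, p.Perm (List.range' 1 n) ∧ p.Sublist w

/-- Flattened `S`-insertion parking functions of order `n`. -/
def flatIns (S : Multiset ℕ) (n : ℕ) : Set (List ℕ) :=
  {w | IsInsertion S n w ∧ IsFlattened w}

/-- Flattened `S`-insertion parking functions of order `n` with exactly `k` runs. -/
def flatInsK (S : Multiset ℕ) (n k : ℕ) : Set (List ℕ) :=
  {w | IsInsertion S n w ∧ IsFlattened w ∧ numRuns w = k}

/-- `f(S; n, k)`, the number of flattened `S`-insertion parking functions of order `n`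
with exactly `k` runs.  In particular `fS 0 n k` is the number of flattened
permutations of `[n]` with `k` runs. -/
noncomputable def fS (S : Multiset ℕ) (n k : ℕ) : ℕ := (flatInsK S n k).ncard

end FlatPF

namespace FlatPF

lemma exists_runs_cons (c : ℕ) (l : List ℕ) : ∃ t rs, runs (c :: l) = (c :: t) :: rs := by
  rw [runs]
  split
  · exact ⟨_, _, rfl⟩
  · exact ⟨_, _, rfl⟩
  · split_ifs <;> exact ⟨_, _, rfl⟩

lemma runs_cons_cons_of_le {c d : ℕ} (h : c ≤ d) {l t : List ℕ} {rs : List (List ℕ)}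
    (e : runs (d :: l) = (d :: t) :: rs) : runs (c :: d :: l) = (c :: d :: t) :: rs := by
  rw [runs, e]
  simp [h]

lemma runs_cons_cons_of_lt {c d : ℕ} (h : d < c) (l : List ℕ) :
    runs (c :: d :: l) = [c] :: runs (d :: l) := by
  obtain ⟨t, rs, e⟩ := exists_runs_cons d l
  rw [runs, e]
  simp [h]

lemma numRuns_cons_cons_of_le {c d : ℕ} (h : c ≤ d) (l : List ℕ) :
    numRuns (c :: d :: l) = numRuns (d :: l) := by
  obtain ⟨t, rs, e⟩ := exists_runs_cons d l
  simp [numRuns, runs_cons_cons_of_le h e, e]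

lemma numRuns_cons_cons_of_lt {c d : ℕ} (h : d < c) (l : List ℕ) :
    numRuns (c :: d :: l) = numRuns (d :: l) + 1 := by
  simp [numRuns, runs_cons_cons_of_lt h]

/-- Every letter that follows a descent is a lower bound for the letters after it. -/
def DescentsMinimal : List ℕ → Prop
  | [] => True
  | [_] => True
  | c :: d :: l => (c ≤ d ∨ ∀ y ∈ l, d ≤ y) ∧ DescentsMinimal (d :: l)

lemma isChain_heads_iff (l : List ℕ) : ∀ {c m : ℕ} {t : List ℕ} {rs : List (List ℕ)},
    runs (c :: l) = (c :: t) :: rs → m ≤ c →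
      (List.IsChain (· ≤ ·) (m :: rs.map (fun r => r.headD 0)) ↔
        DescentsMinimal (c :: l) ∧ ∀ y ∈ l, m ≤ y) := by
  induction l with
  | nil =>
    intro c m t rs h hm
    simp only [runs, List.cons.injEq] at h
    simp [← h.2, DescentsMinimal]
  | cons d l ih =>
    intro c m t rs h hm
    obtain ⟨t', rs', e⟩ := exists_runs_cons d l
    rcases le_or_gt c d with hcd | hcd
    · rw [runs_cons_cons_of_le hcd e, List.cons.injEq] at h
      obtain ⟨-, rfl⟩ := h
      rw [ih e (hm.trans hcd)]
      simp [DescentsMinimal, hcd, hm.trans hcd]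
    · rw [runs_cons_cons_of_lt hcd, e, List.cons.injEq] at h
      obtain ⟨-, rfl⟩ := h
      rw [List.map_cons, List.isChain_cons_cons, List.headD_cons, ih e le_rfl]
      simp only [DescentsMinimal, hcd.not_ge, false_or, List.mem_cons, forall_eq_or_imp]
      constructor
      · rintro ⟨h1, h2, h3⟩
        exact ⟨⟨h3, h2⟩, h1, fun y hy => h1.trans (h3 y hy)⟩
      · rintro ⟨⟨h3, h2⟩, h1, -⟩
        exact ⟨h1, h2, h3⟩

lemma isFlattened_cons_iff (c : ℕ) (l : List ℕ) :
    IsFlattened (c :: l) ↔ DescentsMinimal (c :: l) ∧ ∀ y ∈ l, c ≤ y := by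
  obtain ⟨t, rs, e⟩ := exists_runs_cons c l
  rw [← isChain_heads_iff l e le_rfl]
  simp [IsFlattened, List.Chain', e]

lemma DescentsMinimal.pairwise_and_right {a : ℕ} {v : List ℕ} (u : List ℕ) :
    ∀ {c : ℕ}, DescentsMinimal (c :: (u ++ a :: v)) → (∀ x ∈ u, a < x) →
      (c :: u).Pairwise (· ≤ ·) ∧ DescentsMinimal (a :: v) := by
  induction u with
  | nil => intro c h _; exact ⟨by simp, h.2⟩
  | cons x u ih =>
    intro c h hu
    simp only [List.mem_cons, forall_eq_or_imp] at hu
    obtain ⟨h1, h2⟩ := ih h.2 hu.2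
    refine ⟨?_, h2⟩
    rcases h.1 with hcx | hx
    · rw [← List.isChain_iff_pairwise] at h1 ⊢
      exact List.isChain_cons_cons.2 ⟨hcx, h1⟩
    · exact absurd (hx a (by simp)) hu.1.not_ge

lemma descentsMinimal_and_numRuns_append {a : ℕ} {v : List ℕ} (ha : ∀ y ∈ v, a ≤ y)
    (hv : DescentsMinimal (a :: v)) (u : List ℕ) :
    ∀ {x : ℕ}, (x :: u).Pairwise (· ≤ ·) → (∀ y ∈ x :: u, a < y) →
      DescentsMinimal (x :: (u ++ a :: v)) ∧
        numRuns (x :: (u ++ a :: v)) = numRuns (a :: v) + 1 := by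
  induction u with
  | nil =>
    intro x _ h
    exact ⟨⟨Or.inr ha, hv⟩, numRuns_cons_cons_of_lt (h x (by simp)) v⟩
  | cons z u ih =>
    intro x hp h
    have hxz : x ≤ z := (List.pairwise_cons.1 hp).1 z (by simp)
    obtain ⟨h1, h2⟩ := ih (List.pairwise_cons.1 hp).2 fun y hy => h y (List.mem_cons_of_mem _ hy)
    exact ⟨⟨Or.inl hxz, h1⟩, (numRuns_cons_cons_of_le hxz _).trans h2⟩

lemma descentsMinimal_and_numRuns_cons_append {a c : ℕ} {u v : List ℕ} (ha : ∀ y ∈ v, a ≤ y)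
    (hv : DescentsMinimal (a :: v)) (hu : u.Pairwise (· ≤ ·)) (hau : ∀ y ∈ u, a < y)
    (hca : c ≤ a) :
    DescentsMinimal (c :: (u ++ a :: v)) ∧
      numRuns (c :: (u ++ a :: v)) = numRuns (a :: v) + if u = [] then 0 else 1 := by
  cases u with
  | nil => exact ⟨⟨Or.inl hca, hv⟩, numRuns_cons_cons_of_le hca v⟩
  | cons x u =>
    obtain ⟨h1, h2⟩ := descentsMinimal_and_numRuns_append ha hv u hu hau
    have hcx : c ≤ x := hca.trans (hau x (by simp)).le
    exact ⟨⟨Or.inl hcx, h1⟩, (numRuns_cons_cons_of_le hcx _).trans (by simpa using h2)⟩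

open Finset

/-- The words in the letters `φ x`, `x ∈ S`, each used once, which can follow an initial
letter `c` in a flattened word. -/
abbrev Continuation {α : Type*} (φ : α ↪ ℕ) (c : ℕ) (S : Finset α) : Type :=
  {l : List ℕ // l.Nodup ∧ l.toFinset = S.map φ ∧ DescentsMinimal (c :: l)}

/-- The number of blocks with at least two elements. -/
def bigBlocks {α : Type*} [DecidableEq α] {S : Finset α} (P : Finpartition S) : ℕ :=
  #{b ∈ P.parts | 2 ≤ #b}

variable {α : Type*} [DecidableEq α]

/-- Adjoin the block `insert a B` to a partition. -/
def adjoinBlock {S : Finset α} {a : α} (ha : a ∈ S) :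
    (Σ B : {B // B ⊆ S.erase a}, Finpartition (S.erase a \ B.1)) → Finpartition S :=
  fun x => x.2.extend (b := insert a x.1.1) (insert_ne_empty _ _)
    (by
      rw [Finset.disjoint_left]
      intro y hy
      simp only [mem_sdiff, mem_erase] at hy
      simp [hy.1.1, hy.2])
    (by
      ext y
      have := @x.1.2 y
      simp only [mem_erase] at this
      by_cases hy : y = a
      · simp [hy, ha]
      · simp only [sup_eq_union, mem_union, mem_sdiff, mem_erase, mem_insert]
        tauto)

lemma adjoinBlock_bijective {S : Finset α} {a : α} (ha : a ∈ S) :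
    Function.Bijective (adjoinBlock ha) := by
  have hnot : ∀ {B : Finset α} (Q : Finpartition (S.erase a \ B)), ∀ p ∈ Q.parts, a ∉ p := by
    intro B Q p hp hap
    simpa using Q.subset hp hap
  constructor
  · rintro ⟨⟨B, hB⟩, Q⟩ ⟨⟨C, hC⟩, R⟩ h
    have hparts : insert (insert a B) Q.parts = insert (insert a C) R.parts :=
      congrArg Finpartition.parts h
    have haB : a ∉ B := fun h => by simpa using hB h
    have haC : a ∉ C := fun h => by simpa using hC h
    have hBC : insert a B = insert a C := by
      have : insert a B ∈ insert (insert a C) R.parts := hparts ▸ mem_insert_self _ _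
      rcases mem_insert.1 this with h | h
      · exact h
      · exact absurd (mem_insert_self _ _) (hnot R _ h)
    obtain rfl : B = C := by
      rw [← erase_insert haB, hBC, erase_insert haC]
    have hQR : Q.parts = R.parts := by
      rw [← erase_insert (fun h => hnot Q _ h (mem_insert_self a B)), hparts,
        erase_insert (fun h => hnot R _ h (mem_insert_self a B))]
    obtain rfl : Q = R := Finpartition.ext hQR
    rfl
  · intro P
    have hpm := P.part_mem.2 ha
    have hap : a ∈ P.part a := P.mem_part_self.2 ha
    refine ⟨⟨⟨(P.part a).erase a, erase_subset_erase a (P.part_subset a)⟩,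
      P.ofSubset (erase_subset (P.part a) _) ?_⟩, ?_⟩
    · ext y
      simp only [Finset.mem_sup, mem_erase, id, mem_sdiff]
      constructor
      · rintro ⟨p, ⟨hne, hp⟩, hy⟩
        have hy' : y ∉ P.part a := fun h => hne (P.eq_of_mem_parts hp hpm hy h)
        exact ⟨⟨fun h => hy' (h ▸ hap), P.subset hp hy⟩, fun h => hy' h.2⟩
      · rintro ⟨⟨hya, hyS⟩, hy⟩
        obtain ⟨p, hp, hyp⟩ := P.exists_mem hyS
        exact ⟨p, ⟨fun h => hy ⟨hya, h ▸ hyp⟩, hp⟩, hyp⟩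
    · apply Finpartition.ext
      simp only [adjoinBlock, Finpartition.extend_parts, Finpartition.ofSubset_parts,
        insert_erase hap, insert_erase hpm]

lemma bigBlocks_adjoinBlock {S : Finset α} {a : α} (ha : a ∈ S)
    (x : Σ B : {B // B ⊆ S.erase a}, Finpartition (S.erase a \ B.1)) :
    bigBlocks (adjoinBlock ha x) = bigBlocks x.2 + if x.1.1 = ∅ then 0 else 1 := by
  obtain ⟨⟨B, hB⟩, Q⟩ := x
  have haB : a ∉ B := fun h => by simpa using hB h
  have hQ : insert a B ∉ Q.parts := fun h => by
    simpa using Q.subset h (mem_insert_self a B)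
  simp only [bigBlocks, adjoinBlock, Finpartition.extend_parts, filter_insert,
    card_insert_of_notMem haB]
  rcases B.eq_empty_or_nonempty with rfl | hne
  · simp
  · have := hne.card_pos
    rw [if_pos (by omega), if_neg hne.ne_empty, card_insert_of_notMem (by simp [hQ])]

lemma descentsMinimal_and_numRuns_block_append {φ : α ↪ ℕ} {c : ℕ} {S : Finset α} {a : α}
    (hmin : ∀ x ∈ S, φ a ≤ φ x) (hc : c ≤ φ a) {B : Finset α} (hB : B ⊆ S.erase a)
    (l : Continuation φ (φ a) (S.erase a \ B)) :
    DescentsMinimal (c :: ((B.map φ).sort ++ φ a :: l.1)) ∧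
      numRuns (c :: ((B.map φ).sort ++ φ a :: l.1)) =
        numRuns (φ a :: l.1) + if B = ∅ then 0 else 1 := by
  have hl : ∀ y ∈ l.1, φ a ≤ y := by
    intro y hy
    rw [← List.mem_toFinset, l.2.2.1, mem_map] at hy
    obtain ⟨x, hx, rfl⟩ := hy
    exact hmin x (mem_of_mem_erase (mem_sdiff.1 hx).1)
  have hu : ∀ y ∈ (B.map φ).sort, φ a < y := by
    intro y hy
    rw [mem_sort, mem_map] at hy
    obtain ⟨x, hx, rfl⟩ := hy
    have hx' := mem_erase.1 (hB hx)
    exact lt_of_le_of_ne (hmin x hx'.2) fun h => hx'.1 (φ.injective h).symm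
  have h := descentsMinimal_and_numRuns_cons_append hl l.2.2.2 (pairwise_sort _ _) hu hc
  have hemp : (B.map φ).sort = [] ↔ B = ∅ := by
    rw [← List.toFinset_eq_empty_iff, sort_toFinset, map_eq_empty]
  simpa only [hemp] using h

/-- Prepend the increasing word on `B` and the letter of `a`. -/
def prependBlock {φ : α ↪ ℕ} {c : ℕ} {S : Finset α} {a : α} (ha : a ∈ S)
    (hmin : ∀ x ∈ S, φ a ≤ φ x) (hc : c ≤ φ a) :
    (Σ B : {B // B ⊆ S.erase a}, Continuation φ (φ a) (S.erase a \ B.1)) → Continuation φ c S :=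
  fun x => ⟨(x.1.1.map φ).sort ++ φ a :: x.2.1, by
    obtain ⟨⟨B, hB⟩, l, hnd, hl, hT⟩ := x
    have hmem : ∀ y, y ∈ l ↔ ∃ x ∈ S.erase a \ B, φ x = y := fun y => by
      rw [← List.mem_toFinset, hl, mem_map]
    have haB : a ∉ B := fun h => by simpa using hB h
    refine ⟨?_, ?_, (descentsMinimal_and_numRuns_block_append hmin hc hB ⟨l, hnd, hl, hT⟩).1⟩
    · rw [List.nodup_append', List.nodup_cons]
      refine ⟨sort_nodup _ _, ⟨?_, hnd⟩, ?_⟩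
      · simp [hmem]
      · intro y hy hy'
        rw [mem_sort, mem_map] at hy
        obtain ⟨b, hb, rfl⟩ := hy
        rcases List.mem_cons.1 hy' with h | h
        · exact haB (φ.injective h ▸ hb)
        · obtain ⟨x, hx, hxb⟩ := (hmem _).1 h
          exact (mem_sdiff.1 hx).2 (φ.injective hxb ▸ hb)
    · rw [List.toFinset_append, List.toFinset_cons, sort_toFinset]
      change B.map φ ∪ insert (φ a) l.toFinset = S.map φ
      rw [hl, ← map_insert, ← map_union]
      congr 1
      ext y
      have := @hB y
      simp only [mem_erase] at this
      by_cases hy : y = a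
      · simp [hy, ha]
      · simp only [mem_union, mem_sdiff, mem_erase, mem_insert]
        tauto⟩

lemma eq_of_append_cons_eq_append_cons {β : Type*} {a : β} {u u' v v' : List β}
    (hu : a ∉ u) (hu' : a ∉ u') (h : u ++ a :: v = u' ++ a :: v') : u = u' ∧ v = v' := by
  induction u generalizing u' with
  | nil =>
    cases u' with
    | nil => simpa using h
    | cons x u' => exact absurd (List.cons.inj h).1 (List.ne_of_not_mem_cons hu')
  | cons x u ih =>
    cases u' with
    | nil => exact absurd (List.cons.inj h).1.symm (List.ne_of_not_mem_cons hu)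
    | cons y u' =>
      simp only [List.cons_append, List.cons.injEq, List.mem_cons, not_or] at h hu hu'
      obtain ⟨rfl, rfl⟩ := ih hu.2 hu'.2 h.2
      exact ⟨by rw [h.1], rfl⟩

lemma prependBlock_bijective {φ : α ↪ ℕ} {c : ℕ} {S : Finset α} {a : α} (ha : a ∈ S)
    (hmin : ∀ x ∈ S, φ a ≤ φ x) (hc : c ≤ φ a) :
    Function.Bijective (prependBlock ha hmin hc) := by
  constructor
  · rintro ⟨⟨B, hB⟩, l, hl⟩ ⟨⟨C, hC⟩, m, hm⟩ h
    have hnot : ∀ {D : Finset α}, D ⊆ S.erase a → φ a ∉ (D.map φ).sort := by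
      intro D hD h
      simp only [mem_sort, mem_map'] at h
      simpa using hD h
    obtain ⟨h1, rfl⟩ := eq_of_append_cons_eq_append_cons (hnot hB) (hnot hC)
      (congrArg Subtype.val h)
    obtain rfl : B = C := by
      apply map_injective φ
      rw [← sort_toFinset (B.map φ) (· ≤ ·), h1, sort_toFinset]
    rfl
  · rintro ⟨l, hnd, hl, hT⟩
    have hal : φ a ∈ l := by
      rw [← List.mem_toFinset, hl]
      exact mem_map_of_mem φ ha
    obtain ⟨u, v, rfl⟩ := List.mem_iff_append.1 hal
    have hmem : ∀ x, φ x ∈ u ++ φ a :: v ↔ x ∈ S := fun x => by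
      rw [← List.mem_toFinset, hl, mem_map']
    have hS : ∀ y ∈ u ++ φ a :: v, ∃ x ∈ S, φ x = y := fun y hy => by
      rwa [← List.mem_toFinset, hl, mem_map] at hy
    rw [List.nodup_append', List.nodup_cons] at hnd
    obtain ⟨hu, ⟨hav, hv⟩, hdisj⟩ := hnd
    have hau : φ a ∉ u := fun h => hdisj h (by simp)
    have hlt : ∀ y ∈ u, φ a < y := by
      intro y hy
      obtain ⟨x, hx, rfl⟩ := hS y (by simp [hy])
      exact lt_of_le_of_ne (hmin x hx) fun h => hau (h ▸ hy)
    obtain ⟨hp, hTv⟩ := hT.pairwise_and_right u hlt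
    have hmap : (S.filter (φ · ∈ u)).map φ = u.toFinset := by
      ext y
      simp only [mem_map, mem_filter, List.mem_toFinset]
      constructor
      · rintro ⟨x, ⟨-, hx⟩, rfl⟩
        exact hx
      · intro hy
        obtain ⟨x, hx, rfl⟩ := hS y (by simp [hy])
        exact ⟨x, ⟨hx, hy⟩, rfl⟩
    refine ⟨⟨⟨S.filter (φ · ∈ u), ?_⟩, v, hv, ?_, hTv⟩, ?_⟩
    · intro x hx
      rw [mem_filter] at hx
      exact mem_erase.2 ⟨fun h => hau (h ▸ hx.2), hx.1⟩
    · ext y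
      simp only [mem_map, mem_sdiff, mem_erase, mem_filter, List.mem_toFinset]
      constructor
      · intro hy
        obtain ⟨x, hx, rfl⟩ := hS y (by simp [hy])
        exact ⟨x, ⟨⟨fun h => hav (h ▸ hy), hx⟩, fun h => hdisj h.2 (by simp [hy])⟩, rfl⟩
      · rintro ⟨x, ⟨⟨hxa, hx⟩, hxu⟩, rfl⟩
        have := (hmem x).2 hx
        simp only [List.mem_append, List.mem_cons, φ.injective.eq_iff, hxa, false_or] at this
        exact this.resolve_left fun h => hxu ⟨hx, h⟩
    · apply Subtype.ext
      simp only [prependBlock, hmap]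
      congr 1
      refine List.Perm.eq_of_pairwise (le := (· ≤ ·)) (fun _ _ _ _ => le_antisymm)
        (pairwise_sort _ _) (List.pairwise_cons.1 hp).2 ?_
      exact List.perm_of_nodup_nodup_toFinset_eq (sort_nodup _ _) hu (sort_toFinset _ _)

lemma numRuns_prependBlock {φ : α ↪ ℕ} {c : ℕ} {S : Finset α} {a : α} (ha : a ∈ S)
    (hmin : ∀ x ∈ S, φ a ≤ φ x) (hc : c ≤ φ a)
    (x : Σ B : {B // B ⊆ S.erase a}, Continuation φ (φ a) (S.erase a \ B.1)) :
    numRuns (c :: (prependBlock ha hmin hc x).1) =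
      numRuns (φ a :: x.2.1) + if x.1.1 = ∅ then 0 else 1 :=
  (descentsMinimal_and_numRuns_block_append hmin hc x.1.2 x.2).2

theorem exists_equiv_finpartition (φ : α ↪ ℕ) (S : Finset α) :
    ∀ c : ℕ, (∀ x ∈ S, c ≤ φ x) → ∃ e : Continuation φ c S ≃ Finpartition S,
      ∀ l, numRuns (c :: l.1) = bigBlocks (e l) + 1 := by
  induction S using Finset.strongInduction with
  | H S ih =>
    intro c hc
    rcases S.eq_empty_or_nonempty with rfl | hS
    · have h0 : ∀ l : Continuation φ c ∅, l.1 = [] := fun l => by simpa using l.2.2.1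
      refine ⟨⟨fun _ => Finpartition.empty _, fun _ => ⟨[], by simp [DescentsMinimal]⟩,
        fun l => Subtype.ext (h0 l).symm, fun P => Subsingleton.elim (α := Finpartition ⊥) _ _⟩, ?_⟩
      intro l
      rw [h0 l]
      rfl
    · obtain ⟨a, ha, hmin⟩ := S.exists_min_image φ hS
      have hlt : ∀ B : {B // B ⊆ S.erase a}, S.erase a \ B.1 ⊂ S := fun B =>
        sdiff_subset.trans_ssubset (erase_ssubset ha)
      choose e he using fun B : {B // B ⊆ S.erase a} =>
        ih _ (hlt B) (φ a) fun x hx => hmin x ((hlt B).subset hx)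
      refine ⟨(Equiv.ofBijective _ (prependBlock_bijective ha hmin (hc a ha))).symm.trans
        ((Equiv.sigmaCongrRight e).trans (Equiv.ofBijective _ (adjoinBlock_bijective ha))), ?_⟩
      intro l
      obtain ⟨x, rfl⟩ := (prependBlock_bijective ha hmin (hc a ha)).2 l
      rw [numRuns_prependBlock, Equiv.trans_apply, Equiv.ofBijective_symm_apply_apply,
        Equiv.trans_apply, Equiv.ofBijective_apply, bigBlocks_adjoinBlock, he]
      exact add_right_comm _ _ _

end FlatPF

open FlatPF in
/-- For `n, k ≥ 1`, the number of flattened `{1}`-insertion parking functions of order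
`n` with exactly `k+1` runs equals `T(n,k)`, the number of set partitions of `[n]`
with exactly `k` blocks of size at least two. -/
theorem stmt16 (n k : ℕ) (hn : 1 ≤ n) (hk : 1 ≤ k) :
    fS {1} n (k + 1) =
      Nat.card {P : Finpartition (Finset.univ : Finset (Fin n)) //
        (P.parts.filter (fun b => 2 ≤ b.card)).card = k} := by
  let φ : Fin n ↪ ℕ := ⟨fun i => i + 1, fun i j h => Fin.ext (Nat.succ_injective h)⟩
  have happ : ∀ i : Fin n, φ i = i + 1 := fun _ => rfl
  have hφ : (List.range' 1 n).toFinset = Finset.univ.map φ := by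
    ext x
    simp only [List.mem_toFinset, List.mem_range'_1, Finset.mem_map, Finset.mem_univ, true_and]
    constructor
    · intro h
      exact ⟨⟨x - 1, by omega⟩, by rw [happ]; simp; omega⟩
    · rintro ⟨i, rfl⟩
      have := i.2
      rw [happ]; omega
  have hperm : ∀ l : List ℕ, l.Perm (List.range' 1 n) ↔
      l.Nodup ∧ l.toFinset = Finset.univ.map φ := by
    intro l
    rw [← hφ]
    constructor
    · intro h
      exact ⟨h.nodup_iff.2 List.nodup_range', List.toFinset_eq_of_perm _ _ h⟩
    · rintro ⟨h1, h2⟩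
      exact List.perm_of_nodup_nodup_toFinset_eq h1 List.nodup_range' h2
  have hpos : ∀ {l : List ℕ}, l.Perm (List.range' 1 n) → ∀ y ∈ l, 1 ≤ y := fun h y hy =>
    (List.mem_range'_1.1 (h.mem_iff.1 hy)).1
  obtain ⟨e, he⟩ := exists_equiv_finpartition φ Finset.univ 1 fun x _ => by rw [happ]; omega
  have hset : flatInsK {1} n (k + 1) = (fun l => 1 :: l) ''
      {l | (l.Nodup ∧ l.toFinset = Finset.univ.map φ ∧ DescentsMinimal (1 :: l)) ∧
        numRuns (1 :: l) = k + 1} := by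
    ext w
    simp only [flatInsK, IsInsertion, Set.mem_ofPred_eq, Set.mem_image]
    constructor
    · rintro ⟨⟨hw, -⟩, hf, hr⟩
      rw [add_comm, Multiset.singleton_add, Multiset.cons_coe, Multiset.coe_eq_coe] at hw
      cases w with
      | nil => simp at hw
      | cons c l =>
        rw [isFlattened_cons_iff] at hf
        have hc : c = 1 := by
          have h1 : c ∈ 1 :: List.range' 1 n := hw.mem_iff.1 (by simp)
          have h2 : 1 ∈ c :: l := hw.mem_iff.2 (by simp)
          simp only [List.mem_cons, List.mem_range'_1] at h1 h2
          rcases h2 with h2 | h2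
          · exact h2.symm
          · have := hf.2 1 h2
            omega
        subst hc
        obtain ⟨h1, h2⟩ := (hperm l).1 hw.cons_inv
        exact ⟨l, ⟨⟨h1, h2, hf.1⟩, hr⟩, rfl⟩
    · rintro ⟨l, ⟨⟨h1, h2, h3⟩, hr⟩, rfl⟩
      have hl := (hperm l).2 ⟨h1, h2⟩
      refine ⟨⟨?_, l, hl, List.sublist_cons_self _ _⟩,
        (isFlattened_cons_iff _ _).2 ⟨h3, hpos hl⟩, hr⟩
      rw [add_comm, Multiset.singleton_add, Multiset.cons_coe, Multiset.coe_eq_coe]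
      exact hl.cons 1
  rw [fS, hset, Set.ncard_image_of_injective _ (List.cons_injective), ← Nat.card_coe_set_eq]
  refine Nat.card_congr ((Equiv.subtypeSubtypeEquivSubtypeInter _ _).symm.trans
    (e.subtypeEquiv fun l => ?_))
  rw [he, add_left_inj]
  rfl
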